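/- arXiv:1806.09318 — 2 statements merged into one kernel-verified Lean document; each statement's English description precedes it below -/
import Mathlib

section
/- Let C be a braided monoidal category that is preadditive with tensor product additive in each variable, let ε ∈ {1, −1}, and let H be an object with a finite biproduct decomposition H = ⨁_{i∈ι} H_i (ι a finite index type) such that the braiding satisfies β_{H,H} = ε·𝟙_{H⊗H}. Then for each i, β_{H_i,H_i} = ε·𝟙_{H_i⊗H_i}, and for all i ≠ j the braiding component β_{H_i,H_j} is zero; since β_{H_i,H_j} is an isomorphism, H_i ⊗ H_j is a zero object for i ≠ j. -/
/-!
STATEMENT 4: In a braided monoidal preadditive category with tensor product additive in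
each variable, if `H = ⨁ᵢ Hᵢ` is a finite biproduct and the braiding satisfies
`β_{H,H} = ε • 𝟙` with `ε = ±1`, then `β_{Hᵢ,Hᵢ} = ε • 𝟙` for each `i`, `β_{Hᵢ,Hⱼ} = 0`
for `i ≠ j`, and hence `Hᵢ ⊗ Hⱼ` is a zero object for `i ≠ j`.
-/

open CategoryTheory CategoryTheory.Limits MonoidalCategory

universe v u

/-- If the braiding of `H` with itself is a multiple of the identity, then so is, up to the
composites through `H`, the braiding of any two retracts of `H`. -/
theorem braiding_hom_of_retracts
    {C : Type u} [Category.{v} C] [MonoidalCategory C] [BraidedCategory C]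
    [Preadditive C] {H X Y : C} {n : ℤ} (h : (β_ H H).hom = n • 𝟙 (H ⊗ H))
    (a : X ⟶ H) (p : H ⟶ X) (b : Y ⟶ H) (q : H ⟶ Y) (hap : a ≫ p = 𝟙 X) (hbq : b ≫ q = 𝟙 Y) :
    (β_ X Y).hom = n • ((a ≫ q) ⊗ₘ (b ≫ p)) := by
  calc (β_ X Y).hom
      = (β_ X Y).hom ≫ (b ⊗ₘ a) ≫ (q ⊗ₘ p) := by
        rw [tensorHom_comp_tensorHom, hap, hbq, id_tensorHom_id, Category.comp_id]
    _ = (a ⊗ₘ b) ≫ (β_ H H).hom ≫ (q ⊗ₘ p) := by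
        rw [BraidedCategory.braiding_naturality_assoc]
    _ = n • ((a ≫ q) ⊗ₘ (b ≫ p)) := by
        rw [h, Preadditive.zsmul_comp, Category.id_comp, Preadditive.comp_zsmul,
          tensorHom_comp_tensorHom]

theorem braiding_pm_one_forces_components
    {C : Type u} [Category.{v} C] [MonoidalCategory C] [BraidedCategory C]
    [Preadditive C] [MonoidalPreadditive C]
    {ι : Type} [Fintype ι] (f : ι → C) [HasBiproduct f]
    (ε : ℤ) (hε : ε = 1 ∨ ε = -1)
    (h : (β_ (⨁ f) (⨁ f)).hom = ε • 𝟙 ((⨁ f) ⊗ (⨁ f))) :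
    (∀ i, (β_ (f i) (f i)).hom = ε • 𝟙 (f i ⊗ f i)) ∧
    (∀ i j, i ≠ j → (β_ (f i) (f j)).hom = 0) ∧
    (∀ i j, i ≠ j → IsZero (f i ⊗ f j)) := by
  have key (i j : ι) := braiding_hom_of_retracts h (biproduct.ι f i) (biproduct.π f i)
    (biproduct.ι f j) (biproduct.π f j) (biproduct.ι_π_self f i) (biproduct.ι_π_self f j)
  have braiding_zero (i j : ι) (hij : i ≠ j) : (β_ (f i) (f j)).hom = 0 := by
    rw [key, biproduct.ι_π_ne f hij, MonoidalPreadditive.zero_tensor, smul_zero]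
  refine ⟨fun i => ?_, braiding_zero, fun i j hij => ?_⟩
  · rw [key, biproduct.ι_π_self, id_tensorHom_id]
  · rw [IsZero.iff_id_eq_zero, ← (β_ (f i) (f j)).hom_inv_id, braiding_zero i j hij, zero_comp]
end

section
/- Let G be an abelian group such that for every pair of elements u, v ∈ G there exist a finite index set ι and a family e : ι → G with e_i ⊗ e_j = 0 in G ⊗[ℤ] G whenever i ≠ j, and such that both u and v lie in the ℤ-span of the family {e_i}. Then the swap map on G ⊗[ℤ] G is the identity: for all z ∈ G ⊗[ℤ] G, the canonical isomorphism G ⊗[ℤ] G ≅ G ⊗[ℤ] G sending a ⊗ b to b ⊗ a fixes z; equivalently, u ⊗ v = v ⊗ u for all u, v ∈ G. -/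
/-!
STATEMENT 10: If any two elements of an abelian group `G` lie in the ℤ-span of a finite
family whose distinct members tensor to zero in `G ⊗[ℤ] G`, then the swap map on
`G ⊗[ℤ] G` is the identity.
-/

open TensorProduct

theorem TensorProduct.tmul_comm_of_mem_span {R M : Type*} [CommSemiring R] [AddCommMonoid M]
    [Module R M] {s : Set M} (hs : ∀ x ∈ s, ∀ y ∈ s, x ⊗ₜ[R] y = y ⊗ₜ[R] x) {u v : M}
    (hu : u ∈ Submodule.span R s) (hv : v ∈ Submodule.span R s) :
    u ⊗ₜ[R] v = v ⊗ₜ[R] u := by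
  induction hu, hv using Submodule.span_induction₂ with
  | mem_mem x y hx hy => exact hs x hx y hy
  | zero_left y hy => simp
  | zero_right x hx => simp
  | add_left x y z _ _ _ h₁ h₂ => rw [add_tmul, tmul_add, h₁, h₂]
  | add_right x y z _ _ _ h₁ h₂ => rw [add_tmul, tmul_add, h₁, h₂]
  | smul_left r x y _ _ h => rw [← smul_tmul', tmul_smul, h]
  | smul_right r x y _ _ h => rw [← smul_tmul', tmul_smul, h]

theorem swap_eq_id_of_orthogonal_families
    (G : Type) [AddCommGroup G]
    (h : ∀ u v : G, ∃ (ι : Type) (_ : Fintype ι) (e : ι → G),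
      (∀ i j : ι, i ≠ j → e i ⊗ₜ[ℤ] e j = (0 : G ⊗[ℤ] G)) ∧
      u ∈ Submodule.span ℤ (Set.range e) ∧ v ∈ Submodule.span ℤ (Set.range e)) :
    (∀ u v : G, u ⊗ₜ[ℤ] v = v ⊗ₜ[ℤ] u) ∧
    (∀ z : G ⊗[ℤ] G, TensorProduct.comm ℤ G G z = z) := by
  have key : ∀ u v : G, u ⊗ₜ[ℤ] v = v ⊗ₜ[ℤ] u := by
    intro u v
    obtain ⟨ι, _, e, he, hu, hv⟩ := h u v
    refine TensorProduct.tmul_comm_of_mem_span ?_ hu hv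
    rintro _ ⟨i, rfl⟩ _ ⟨j, rfl⟩
    obtain rfl | hij := eq_or_ne i j
    · rfl
    · rw [he i j hij, he j i hij.symm]
  refine ⟨key, fun z => ?_⟩
  induction z with
  | zero => simp
  | tmul u v => rw [TensorProduct.comm_tmul, key]
  | add x y hx hy => rw [map_add, hx, hy]
end
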